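/- arXiv:1608.07243 — 5 statements merged into one kernel-verified Lean document; each statement's English description precedes it below -/
import Mathlib

section
/- Let u, v : ℝ → ℝ be smooth functions and let Ω = {(q1,q2,q3) ∈ ℝ³ : u(q2) + v(q3) ≠ 0}. Then the functions H = (1/2)p1² + (1/(u(q2)+v(q3)))·((1/2)p2² + (1/2)p3²) and K = (1/(u(q2)+v(q3)))·(v(q3)·p2² − u(q2)·p3²), defined on Ω × ℝ³, have vanishing Poisson bracket: {H, K} = 0 at every point of Ω × ℝ³. -/
open Real

/-- Partial derivative of `F(q,p)` with respect to the coordinate `q i`. -/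
noncomputable def pdq {n : ℕ} (i : Fin n) (F : (Fin n → ℝ) → (Fin n → ℝ) → ℝ)
    (q p : Fin n → ℝ) : ℝ :=
  deriv (fun t => F (Function.update q i t) p) (q i)

/-- Partial derivative of `F(q,p)` with respect to the momentum `p i`. -/
noncomputable def pdp {n : ℕ} (i : Fin n) (F : (Fin n → ℝ) → (Fin n → ℝ) → ℝ)
    (q p : Fin n → ℝ) : ℝ :=
  deriv (fun t => F q (Function.update p i t)) (p i)

/-- Canonical Poisson bracket `{F,G} = ∑ i, (∂F/∂qⁱ ∂G/∂pᵢ − ∂F/∂pᵢ ∂G/∂qⁱ)`. -/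
noncomputable def poissonBracket {n : ℕ} (F G : (Fin n → ℝ) → (Fin n → ℝ) → ℝ)
    (q p : Fin n → ℝ) : ℝ :=
  ∑ i, (pdq i F q p * pdp i G q p - pdp i F q p * pdq i G q p)

/-- Derivative of a constant plus an affine function of `f` divided by a translate of `f`. -/
theorem deriv_const_add_div_translate {f : ℝ → ℝ} {x : ℝ} (hf : DifferentiableAt ℝ f x)
    (a c d e : ℝ) (hx : f x + c ≠ 0) :
    deriv (fun t => a + (d + e * f t) / (f t + c)) x =
      deriv f x * (e * c - d) / (f x + c) ^ 2 := by
  have h := (((hf.hasDerivAt.const_mul e).const_add d).div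
    (hf.hasDerivAt.add_const c) hx).const_add a
  refine h.deriv.trans ?_
  ring

/-- Derivative of a real quadratic polynomial without linear term. -/
theorem deriv_const_add_mul_sq (a b x : ℝ) : deriv (fun t => a + b * t ^ 2) x = 2 * b * x := by
  have h := ((hasDerivAt_pow 2 x).const_mul b).const_add a
  refine h.deriv.trans ?_
  norm_num
  ring

theorem stmt_0 (u v : ℝ → ℝ) (hu : ContDiff ℝ (⊤ : ℕ∞) u) (hv : ContDiff ℝ (⊤ : ℕ∞) v)
    (q p : Fin 3 → ℝ) (hq : u (q 1) + v (q 2) ≠ 0) :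
    poissonBracket
      (fun q p => (1/2) * (p 0)^2 +
        (1/(u (q 1) + v (q 2))) * ((1/2) * (p 1)^2 + (1/2) * (p 2)^2))
      (fun q p => (1/(u (q 1) + v (q 2))) * (v (q 2) * (p 1)^2 - u (q 1) * (p 2)^2))
      q p = 0 := by
  have du : DifferentiableAt ℝ u (q 1) := hu.differentiable (by simp) _
  have dv : DifferentiableAt ℝ v (q 2) := hv.differentiable (by simp) _
  have hq' : v (q 2) + u (q 1) ≠ 0 := by rwa [add_comm]
  have H1 := deriv_const_add_div_translate du ((1/2) * (p 0)^2) (v (q 2))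
    ((1/2) * (p 1)^2 + (1/2) * (p 2)^2) 0 hq
  have H2 := deriv_const_add_div_translate dv ((1/2) * (p 0)^2) (u (q 1))
    ((1/2) * (p 1)^2 + (1/2) * (p 2)^2) 0 hq'
  have K1 := deriv_const_add_div_translate du 0 (v (q 2)) (v (q 2) * (p 1)^2) (-(p 2)^2) hq
  have K2 := deriv_const_add_div_translate dv 0 (u (q 1)) (-(u (q 1) * (p 2)^2)) ((p 1)^2) hq'
  have h1 := deriv_const_add_mul_sq ((1/2) * (p 0)^2 + (1/(u (q 1) + v (q 2))) * ((1/2) * (p 2)^2))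
    ((1/(u (q 1) + v (q 2))) * (1/2)) (p 1)
  have h2 := deriv_const_add_mul_sq ((1/2) * (p 0)^2 + (1/(u (q 1) + v (q 2))) * ((1/2) * (p 1)^2))
    ((1/(u (q 1) + v (q 2))) * (1/2)) (p 2)
  have k1 := deriv_const_add_mul_sq (-((1/(u (q 1) + v (q 2))) * (u (q 1) * (p 2)^2)))
    ((1/(u (q 1) + v (q 2))) * v (q 2)) (p 1)
  have k2 := deriv_const_add_mul_sq ((1/(u (q 1) + v (q 2))) * (v (q 2) * (p 1)^2))
    (-((1/(u (q 1) + v (q 2))) * u (q 1))) (p 2)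
  simp only [poissonBracket, pdq, pdp, Fin.sum_univ_three, Function.update_self, ne_eq,
    Fin.reduceEq, not_false_eq_true, Function.update_of_ne, deriv_const, mul_zero,
    sub_zero, zero_add]
  rw [show deriv (fun t => (1/2) * (p 0)^2 +
        (1/(u t + v (q 2))) * ((1/2) * (p 1)^2 + (1/2) * (p 2)^2)) (q 1) = _ from
      (congrArg (deriv · (q 1)) (by funext t; ring)).trans H1,
    show deriv (fun t => (1/2) * (p 0)^2 +
        (1/(u (q 1) + v t)) * ((1/2) * (p 1)^2 + (1/2) * (p 2)^2)) (q 2) = _ from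
      (congrArg (deriv · (q 2)) (by funext t; ring)).trans H2,
    show deriv (fun t => (1/(u t + v (q 2))) * (v (q 2) * (p 1)^2 - u t * (p 2)^2)) (q 1) = _ from
      (congrArg (deriv · (q 1)) (by funext t; ring)).trans K1,
    show deriv (fun t => (1/(u (q 1) + v t)) * (v t * (p 1)^2 - u (q 1) * (p 2)^2)) (q 2) = _ from
      (congrArg (deriv · (q 2)) (by funext t; ring)).trans K2,
    show deriv (fun t => (1/2) * (p 0)^2 +
        (1/(u (q 1) + v (q 2))) * ((1/2) * t^2 + (1/2) * (p 2)^2)) (p 1) = _ from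
      (congrArg (deriv · (p 1)) (by funext t; ring)).trans h1,
    show deriv (fun t => (1/2) * (p 0)^2 +
        (1/(u (q 1) + v (q 2))) * ((1/2) * (p 1)^2 + (1/2) * t^2)) (p 2) = _ from
      (congrArg (deriv · (p 2)) (by funext t; ring)).trans h2,
    show deriv (fun t => (1/(u (q 1) + v (q 2))) * (v (q 2) * t^2 - u (q 1) * (p 2)^2)) (p 1) = _
      from (congrArg (deriv · (p 1)) (by funext t; ring)).trans k1,
    show deriv (fun t => (1/(u (q 1) + v (q 2))) * (v (q 2) * (p 1)^2 - u (q 1) * t^2)) (p 2) = _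
      from (congrArg (deriv · (p 2)) (by funext t; ring)).trans k2,
    add_comm (v (q 2))]
  field_simp
  ring
end

section
/- Let u, v : ℝ → ℝ be smooth and let Ω = {(q1,q2,q3) ∈ ℝ³ : u(q2) + v(q3) > 0}. Define, for smooth f : Ω → ℝ, the operators Δf = ∂²f/∂q1² + (1/(u(q2)+v(q3)))·(∂²f/∂q2² + ∂²f/∂q3²) and Δ_K f = (1/(u(q2)+v(q3)))·(2·v(q3)·∂²f/∂q2² − 2·u(q2)·∂²f/∂q3²). Then Δ and Δ_K commute: Δ(Δ_K f) = Δ_K(Δ f) for every smooth f : Ω → ℝ. -/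
open Real

/-- Partial derivative of `f` with respect to the `i`-th coordinate. -/
noncomputable def pd {n : ℕ} (i : Fin n) (f : (Fin n → ℝ) → ℝ) (x : Fin n → ℝ) : ℝ :=
  deriv (fun t => f (Function.update x i t)) (x i)

/-- The operator `f ↦ ρ⁻¹ ∑ a b, ∂_a (ρ K^{ab} ∂_b f)` (Laplace–Beltrami-type
quantization of the symmetric tensor field `K` with respect to the weight `ρ`). -/
noncomputable def lapOp {n : ℕ} (ρ : (Fin n → ℝ) → ℝ) (K : (Fin n → ℝ) → Fin n → Fin n → ℝ)
    (f : (Fin n → ℝ) → ℝ) (x : Fin n → ℝ) : ℝ :=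
  (ρ x)⁻¹ * ∑ a, ∑ b, pd a (fun y => ρ y * K y a b * pd b f y) x

/-- The Laplace–Beltrami operator of the metric `g¹¹ = 1`, `g²² = g³³ = 1/(u(q2)+v(q3))`. -/
noncomputable def lapH (u v : ℝ → ℝ) (f : (Fin 3 → ℝ) → ℝ) (x : Fin 3 → ℝ) : ℝ :=
  pd 0 (pd 0 f) x + (1/(u (x 1) + v (x 2))) * (pd 1 (pd 1 f) x + pd 2 (pd 2 f) x)

/-- The Laplace–Beltrami quantization `Δ_K` of the Killing tensor
`K²² = 2v(q3)/(u+v)`, `K³³ = −2u(q2)/(u+v)`. -/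
noncomputable def lapK (u v : ℝ → ℝ) (f : (Fin 3 → ℝ) → ℝ) (x : Fin 3 → ℝ) : ℝ :=
  (1/(u (x 1) + v (x 2))) *
    (2 * v (x 2) * pd 1 (pd 1 f) x - 2 * u (x 1) * pd 2 (pd 2 f) x)

section PartialDerivatives

variable {n : ℕ} {U : Set (Fin n → ℝ)} {f g f₁ f₂ a b : (Fin n → ℝ) → ℝ} {x : Fin n → ℝ}

lemma eventually_update_mem (hU : IsOpen U) (hx : x ∈ U) (i : Fin n) :
    ∀ᶠ t in nhds (x i), Function.update x i t ∈ U := by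
  have hc : Continuous fun t : ℝ => Function.update x i t := by fun_prop
  exact hc.continuousAt.eventually (by simpa using hU.mem_nhds hx)

lemma pd_congr_of_eqOn (hU : IsOpen U) (h : Set.EqOn f g U) (hx : x ∈ U) (i : Fin n) :
    pd i f x = pd i g x :=
  Filter.EventuallyEq.deriv_eq ((eventually_update_mem hU hx i).mono fun _ ht => h ht)

lemma hasDerivAt_update_of_contDiffOn (hU : IsOpen U) (hf : ContDiffOn ℝ (⊤ : ℕ∞) f U)
    (hx : x ∈ U) (i : Fin n) :
    HasDerivAt (fun t => f (Function.update x i t)) (fderiv ℝ f x (Pi.single i 1)) (x i) := by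
  have hd : DifferentiableAt ℝ f (Function.update x i (x i)) := by
    simpa using (hf.contDiffAt (hU.mem_nhds hx)).differentiableAt (by simp)
  simpa [Function.comp_def] using
    hd.hasFDerivAt.comp_hasDerivAt (x i) (hasDerivAt_update x i (x i))

lemma pd_eq_fderiv (hU : IsOpen U) (hf : ContDiffOn ℝ (⊤ : ℕ∞) f U) (hx : x ∈ U) (i : Fin n) :
    pd i f x = fderiv ℝ f x (Pi.single i 1) :=
  (hasDerivAt_update_of_contDiffOn hU hf hx i).deriv

lemma contDiffOn_pd (hU : IsOpen U) (hf : ContDiffOn ℝ (⊤ : ℕ∞) f U) (i : Fin n) :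
    ContDiffOn ℝ (⊤ : ℕ∞) (pd i f) U :=
  ((hf.fderiv_of_isOpen hU (m := (⊤ : ℕ∞)) (by simp)).clm_apply contDiffOn_const).congr
    fun _ hy => pd_eq_fderiv hU hf hy i

lemma pd_comm (hU : IsOpen U) (hf : ContDiffOn ℝ (⊤ : ℕ∞) f U) (hx : x ∈ U) (i j : Fin n) :
    pd i (pd j f) x = pd j (pd i f) x := by
  have hd : DifferentiableAt ℝ (fderiv ℝ f) x :=
    ((hf.fderiv_of_isOpen hU (m := (⊤ : ℕ∞)) (by simp)).contDiffAt
      (hU.mem_nhds hx)).differentiableAt (by simp)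
  have key (k l : Fin n) :
      pd k (pd l f) x = fderiv ℝ (fderiv ℝ f) x (Pi.single k 1) (Pi.single l 1) := by
    have he : pd l f =ᶠ[nhds x] fun y => fderiv ℝ f y (Pi.single l 1) :=
      Filter.eventually_of_mem (hU.mem_nhds hx) fun _ hy => pd_eq_fderiv hU hf hy l
    rw [pd_eq_fderiv hU (contDiffOn_pd hU hf l) hx k, he.fderiv_eq,
      fderiv_clm_apply hd (differentiableAt_const _)]
    simp
  rw [key, key]
  exact ((hf.contDiffAt (hU.mem_nhds hx)).isSymmSndFDerivAt
    (by simpa using WithTop.coe_le_coe.2 (le_top : (2 : ℕ∞) ≤ ⊤))).eq _ _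

lemma pd_pd_comm (hU : IsOpen U) (hf : ContDiffOn ℝ (⊤ : ℕ∞) f U) (hx : x ∈ U) (i j : Fin n) :
    pd i (pd i (pd j (pd j f))) x = pd j (pd j (pd i (pd i f))) x := by
  have hi := contDiffOn_pd hU hf i
  have hj := contDiffOn_pd hU hf j
  calc pd i (pd i (pd j (pd j f))) x
      = pd i (pd j (pd i (pd j f))) x :=
        pd_congr_of_eqOn hU (fun _ hy => pd_comm hU hj hy i j) hx i
    _ = pd j (pd i (pd i (pd j f))) x := pd_comm hU (contDiffOn_pd hU hj i) hx i j
    _ = pd j (pd i (pd j (pd i f))) x :=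
        pd_congr_of_eqOn hU (fun _ hy => pd_congr_of_eqOn hU
          (fun _ hz => pd_comm hU hf hz i j) hy i) hx j
    _ = pd j (pd j (pd i (pd i f))) x :=
        pd_congr_of_eqOn hU (fun _ hy => pd_comm hU hi hy i j) hx j

/-- Functions independent of the `i`-th coordinate act as constants for `pd i`. -/
lemma pd_of_eqOn_linear_combination (hU : IsOpen U) (i : Fin n)
    (ha : ∀ y t, a (Function.update y i t) = a y) (hb : ∀ y t, b (Function.update y i t) = b y)
    (h₁ : ContDiffOn ℝ (⊤ : ℕ∞) f₁ U) (h₂ : ContDiffOn ℝ (⊤ : ℕ∞) f₂ U)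
    (h : Set.EqOn g (fun y => a y * f₁ y + b y * f₂ y) U) (hx : x ∈ U) :
    pd i g x = a x * pd i f₁ x + b x * pd i f₂ x := by
  rw [pd_congr_of_eqOn hU h hx i, pd_eq_fderiv hU h₁ hx, pd_eq_fderiv hU h₂ hx]
  simp only [pd, ha, hb]
  exact (((hasDerivAt_update_of_contDiffOn hU h₁ hx i).const_mul (a x)).add
    ((hasDerivAt_update_of_contDiffOn hU h₂ hx i).const_mul (b x))).deriv

lemma pd_pd_of_eqOn_linear_combination (hU : IsOpen U) (i : Fin n)
    (ha : ∀ y t, a (Function.update y i t) = a y) (hb : ∀ y t, b (Function.update y i t) = b y)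
    (h₁ : ContDiffOn ℝ (⊤ : ℕ∞) f₁ U) (h₂ : ContDiffOn ℝ (⊤ : ℕ∞) f₂ U)
    (h : Set.EqOn g (fun y => a y * f₁ y + b y * f₂ y) U) (hx : x ∈ U) :
    pd i (pd i g) x = a x * pd i (pd i f₁) x + b x * pd i (pd i f₂) x :=
  pd_of_eqOn_linear_combination hU i ha hb (contDiffOn_pd hU h₁ i) (contDiffOn_pd hU h₂ i)
    (fun _ hy => pd_of_eqOn_linear_combination hU i ha hb h₁ h₂ h hy) hx

end PartialDerivatives

theorem stmt_1 (u v : ℝ → ℝ) (hu : ContDiff ℝ (⊤ : ℕ∞) u) (hv : ContDiff ℝ (⊤ : ℕ∞) v)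
    (f : (Fin 3 → ℝ) → ℝ)
    (hf : ContDiffOn ℝ (⊤ : ℕ∞) f {x : Fin 3 → ℝ | 0 < u (x 1) + v (x 2)}) :
    ∀ x : Fin 3 → ℝ, 0 < u (x 1) + v (x 2) →
      lapH u v (lapK u v f) x = lapK u v (lapH u v f) x := by
  intro x hx
  set U : Set (Fin 3 → ℝ) := {x | 0 < u (x 1) + v (x 2)} with hUdef
  have hu' : ContDiff ℝ (⊤ : ℕ∞) fun y : Fin 3 → ℝ => u (y 1) := hu.comp (contDiff_apply ℝ ℝ 1)
  have hv' : ContDiff ℝ (⊤ : ℕ∞) fun y : Fin 3 → ℝ => v (y 2) := hv.comp (contDiff_apply ℝ ℝ 2)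
  have hU : IsOpen U := isOpen_lt continuous_const (hu'.continuous.add hv'.continuous)
  have hxU : x ∈ U := hx
  have hs (y : Fin 3 → ℝ) (hy : y ∈ U) : u (y 1) + v (y 2) ≠ 0 := ne_of_gt hy
  have hff (i : Fin 3) : ContDiffOn ℝ (⊤ : ℕ∞) (pd i (pd i f)) U :=
    contDiffOn_pd hU (contDiffOn_pd hU hf i) i
  -- `K f = 2 (v H f - ∂₃² f) = 2 (∂₂² f - u H f)`, where `H` is the `(q2, q3)`-part of `lapH`.
  let H : (Fin 3 → ℝ) → ℝ := fun y =>
    (1 / (u (y 1) + v (y 2))) * (pd 1 (pd 1 f) y + pd 2 (pd 2 f) y)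
  have hH : ContDiffOn ℝ (⊤ : ℕ∞) H U :=
    (contDiffOn_const.div (hu'.add hv').contDiffOn hs).mul ((hff 1).add (hff 2))
  have hK₀ := pd_pd_of_eqOn_linear_combination (g := lapK u v f) hU 0
    (a := fun y => 2 * v (y 2) / (u (y 1) + v (y 2)))
    (b := fun y => -(2 * u (y 1) / (u (y 1) + v (y 2))))
    (by simp) (by simp) (hff 1) (hff 2) (fun y _ => by simp only [lapK]; ring) hxU
  have hK₁ := pd_pd_of_eqOn_linear_combination (g := lapK u v f) hU 1
    (a := fun y => 2 * v (y 2)) (b := fun _ => -2) (by simp) (by simp) hH (hff 2)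
    (fun y hy => by have := hs y hy; simp only [lapK, H]; field_simp; ring) hxU
  have hK₂ := pd_pd_of_eqOn_linear_combination (g := lapK u v f) hU 2
    (a := fun y => -(2 * u (y 1))) (b := fun _ => 2) (by simp) (by simp) hH (hff 1)
    (fun y hy => by have := hs y hy; simp only [lapK, H]; field_simp; ring) hxU
  have hL (i : Fin 3) := pd_pd_of_eqOn_linear_combination (g := lapH u v f) hU i
    (a := fun _ => 1) (b := fun _ => 1) (by simp) (by simp) (hff 0) hH
    (fun y _ => by simp only [lapH, H]; ring) hxU
  rw [lapH, lapK, hK₀, hK₁, hK₂, hL 1, hL 2, pd_pd_comm hU hf hxU 0 1, pd_pd_comm hU hf hxU 0 2,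
    pd_pd_comm hU hf hxU 2 1]
  ring
end

section
/- Fix a ∈ ℝ, a ≠ 0, and let Ω = {(r,φ,z) ∈ ℝ³ : r ≠ 0 and z ≠ 0}. Then the functions H = (1/2)p_r² + (1/2)p_z² + (1/2)·(1/r² − a²/z²)·p_φ² and K = (1/2)p_r² + (1/(2r²))·p_φ², defined on Ω × ℝ³, have vanishing Poisson bracket: {H, K} = 0 at every point of Ω × ℝ³. -/
open Real

/-- Adding a function that does not depend on `q i` leaves the partial derivative unchanged. -/
theorem pdq_eq_of_forall_update {n : ℕ} {i : Fin n} {F G : (Fin n → ℝ) → (Fin n → ℝ) → ℝ}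
    {q p : Fin n → ℝ} (c : ℝ)
    (h : ∀ t, F (Function.update q i t) p = G (Function.update q i t) p + c) :
    pdq i F q p = pdq i G q p := by
  simp only [pdq, h, deriv_add_const]

/-- Adding a function that does not depend on `p i` leaves the partial derivative unchanged. -/
theorem pdp_eq_of_forall_update {n : ℕ} {i : Fin n} {F G : (Fin n → ℝ) → (Fin n → ℝ) → ℝ}
    {q p : Fin n → ℝ} (c : ℝ)
    (h : ∀ t, F q (Function.update p i t) = G q (Function.update p i t) + c) :
    pdp i F q p = pdp i G q p := by
  simp only [pdp, h, deriv_add_const]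

theorem stmt_2 (a : ℝ) (ha : a ≠ 0) (q p : Fin 3 → ℝ) (hr : q 0 ≠ 0) (hz : q 2 ≠ 0) :
    poissonBracket
      (fun q p => (1/2) * (p 0)^2 + (1/2) * (p 2)^2 +
        (1/2) * (1/(q 0)^2 - a^2/(q 2)^2) * (p 1)^2)
      (fun q p => (1/2) * (p 0)^2 + (1/(2 * (q 0)^2)) * (p 1)^2)
      q p = 0 := by
  rw [poissonBracket, Fin.sum_univ_three,
    pdq_eq_of_forall_update (i := 0) (F := fun q p => (1/2) * (p 0)^2 + (1/2) * (p 2)^2 +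
        (1/2) * (1/(q 0)^2 - a^2/(q 2)^2) * (p 1)^2)
      (G := fun q p => (1/2) * (p 0)^2 + (1/(2 * (q 0)^2)) * (p 1)^2)
      ((1/2) * (p 2)^2 - (1/2) * (a^2/(q 2)^2) * (p 1)^2)
      (fun t => by simp; ring),
    pdp_eq_of_forall_update (i := 0) (F := fun q p => (1/2) * (p 0)^2 + (1/2) * (p 2)^2 +
        (1/2) * (1/(q 0)^2 - a^2/(q 2)^2) * (p 1)^2)
      (G := fun q p => (1/2) * (p 0)^2 + (1/(2 * (q 0)^2)) * (p 1)^2)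
      ((1/2) * (p 2)^2 - (1/2) * (a^2/(q 2)^2) * (p 1)^2)
      (fun t => by simp; ring)]
  simp [pdq, pdp, mul_comm]
end

section
/- Let Ω = {(q1,q2) ∈ ℝ² : 0 < q2 < π}. Then the functions H2 = (1/2)p2² + (2/sin²q2)·p1² and K2 = cos(q1)·p2² − 4·sin(q1)·(cos q2/sin q2)·p1·p2 − 4·cos(q1)·(cos²q2/sin²q2)·p1², defined on Ω × ℝ², have vanishing Poisson bracket: {H2, K2} = 0 at every point of Ω × ℝ². -/
open Real

theorem stmt_4 (q p : Fin 2 → ℝ) (h1 : 0 < q 1) (h2 : q 1 < π) :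
    poissonBracket
      (fun q p => (1/2) * (p 1)^2 + (2/(sin (q 1))^2) * (p 0)^2)
      (fun q p => cos (q 0) * (p 1)^2 -
        4 * sin (q 0) * (cos (q 1)/sin (q 1)) * (p 0) * (p 1) -
        4 * cos (q 0) * ((cos (q 1))^2/(sin (q 1))^2) * (p 0)^2)
      q p = 0 := by
  have hs : sin (q 1) ≠ 0 := (sin_pos_of_pos_of_lt_pi h1 h2).ne'
  have hsin := hasDerivAt_sin (q 1)
  have hcos := hasDerivAt_cos (q 1)
  have hH₂ := (((hsin.pow 2).inv (pow_ne_zero 2 hs)).const_mul (2 * (p 0) ^ 2)).const_add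
    (1 / 2 * (p 1) ^ 2)
  have hcot := hcos.div hsin hs
  have hK₁ := (((hasDerivAt_cos (q 0)).mul_const ((p 1) ^ 2)).sub
    ((hasDerivAt_sin (q 0)).mul_const (4 * (cos (q 1) / sin (q 1)) * p 0 * p 1))).sub
    ((hasDerivAt_cos (q 0)).mul_const (4 * ((cos (q 1)) ^ 2 / (sin (q 1)) ^ 2) * (p 0) ^ 2))
  have hK₂ := ((hcot.const_mul (4 * sin (q 0) * p 0 * p 1)).const_sub
    (cos (q 0) * (p 1) ^ 2)).sub ((hcot.pow 2).const_mul (4 * cos (q 0) * (p 0) ^ 2))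
  have hp₀ := hasDerivAt_id (p 0)
  have hp₁ := hasDerivAt_id (p 1)
  have hHp₁ := ((hp₀.pow 2).const_mul (2 / (sin (q 1)) ^ 2)).const_add (1 / 2 * (p 1) ^ 2)
  have hHp₂ := ((hp₁.pow 2).const_mul (1 / 2)).add_const (2 / (sin (q 1)) ^ 2 * (p 0) ^ 2)
  have hKp₂ := (((hp₁.pow 2).const_mul (cos (q 0))).sub
    (hp₁.const_mul (4 * sin (q 0) * (cos (q 1) / sin (q 1)) * p 0))).sub_const
    (4 * cos (q 0) * ((cos (q 1)) ^ 2 / (sin (q 1)) ^ 2) * (p 0) ^ 2)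
  simp only [poissonBracket, pdq, pdp, Fin.sum_univ_two, Function.update_self, ne_eq,
    zero_ne_one, one_ne_zero, not_false_eq_true, Function.update_of_ne, deriv_const, zero_mul,
    zero_sub]
  rw [(hH₂.congr_of_eventuallyEq (.of_forall fun t => ?_)).deriv,
    (hK₁.congr_of_eventuallyEq (.of_forall fun t => ?_)).deriv,
    (hK₂.congr_of_eventuallyEq (.of_forall fun t => ?_)).deriv,
    (hHp₁.congr_of_eventuallyEq (.of_forall fun t => ?_)).deriv,
    (hKp₂.congr_of_eventuallyEq (.of_forall fun t => ?_)).deriv,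
    (hHp₂.congr_of_eventuallyEq (.of_forall fun t => ?_)).deriv]
  · have hd : -sin (q 1) * sin (q 1) - cos (q 1) * cos (q 1) = -1 := by
      linarith [sin_sq_add_cos_sq (q 1)]
    simp only [hd, Pi.div_apply, Pi.pow_apply, id_eq, Nat.cast_ofNat, Nat.reduceSub,
      pow_one]
    field_simp
    ring
  all_goals
    simp [div_eq_mul_inv]
    try ring_nf
end

section
/- Let Ω = {(q1,q2,q3) ∈ ℝ³ : 0 < q2 < π, 0 < q3 < π}, H2 = (1/2)p2² + (2/sin²q2)·p1², H3 = (1/2)p3² + (4/sin²q3)·H2, and K3 = cos(q2)·p3² − 4·sin(q2)·(cos q3/sin q3)·p2·p3 − 8·cos(q2)·(cos²q3/sin²q3)·H2. Then {H3, K3} = 0 at every point of Ω × ℝ³. -/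
open Real

/-- `H2 = (1/2)p2² + (2/sin²q2) p1²`. -/
noncomputable def H2 (q p : Fin 3 → ℝ) : ℝ :=
  (1/2) * (p 1)^2 + (2/(sin (q 1))^2) * (p 0)^2

/-- `H3 = (1/2)p3² + (4/sin²q3) H2`. -/
noncomputable def H3 (q p : Fin 3 → ℝ) : ℝ :=
  (1/2) * (p 2)^2 + (4/(sin (q 2))^2) * H2 q p

/-- `K3`, the additional quadratic first integral produced by the extension. -/
noncomputable def K3 (q p : Fin 3 → ℝ) : ℝ :=
  cos (q 1) * (p 2)^2 - 4 * sin (q 1) * (cos (q 2)/sin (q 2)) * (p 1) * (p 2) -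
    8 * cos (q 1) * ((cos (q 2))^2/(sin (q 2))^2) * H2 q p

theorem hasDerivAt_inv_sin_sq {x : ℝ} (hx : sin x ≠ 0) :
    HasDerivAt (fun t => 1 / sin t ^ 2) (-2 * cos x / sin x ^ 3) x := by
  refine ((hasDerivAt_const x (1 : ℝ)).fun_div ((hasDerivAt_sin x).fun_pow 2)
    (pow_ne_zero 2 hx)).congr_deriv ?_
  simp only [Nat.cast_ofNat, Nat.add_one_sub_one, pow_one]
  field_simp
  ring

theorem hasDerivAt_cos_div_sin {x : ℝ} (hx : sin x ≠ 0) :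
    HasDerivAt (fun t => cos t / sin t) (-1 / sin x ^ 2) x := by
  refine ((hasDerivAt_cos x).fun_div (hasDerivAt_sin x) hx).congr_deriv ?_
  congr 1
  linear_combination -sin_sq_add_cos_sq x

/-- The derivative of a quadratic polynomial. -/
theorem deriv_quadratic (a b c x : ℝ) :
    deriv (fun t => a * t ^ 2 + b * t + c) x = 2 * a * x + b := by
  have h := ((((hasDerivAt_id x).fun_pow 2).const_mul a).fun_add
    ((hasDerivAt_id x).const_mul b)).add_const c
  refine Eq.trans h.deriv ?_
  simp
  ring

theorem pdq_zero_H3 (q p : Fin 3 → ℝ) : pdq 0 H3 q p = 0 := by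
  simp [pdq, H3, H2]

theorem pdq_zero_K3 (q p : Fin 3 → ℝ) : pdq 0 K3 q p = 0 := by
  simp [pdq, K3, H2]

theorem pdq_one_H3 (q p : Fin 3 → ℝ) (h : sin (q 1) ≠ 0) :
    pdq 1 H3 q p = -16 * cos (q 1) / (sin (q 1) ^ 3 * sin (q 2) ^ 2) * p 0 ^ 2 := by
  have key := ((hasDerivAt_inv_sin_sq h).const_mul (8 / sin (q 2) ^ 2 * p 0 ^ 2)).const_add
    (1 / 2 * p 2 ^ 2 + 2 / sin (q 2) ^ 2 * p 1 ^ 2)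
  convert key.deriv using 1
  · unfold pdq
    congr 1
    funext t
    simp [H3, H2]
    ring
  · field_simp
    ring

theorem pdq_two_H3 (q p : Fin 3 → ℝ) (h : sin (q 2) ≠ 0) :
    pdq 2 H3 q p = -8 * cos (q 2) / sin (q 2) ^ 3 * H2 q p := by
  have key := ((hasDerivAt_inv_sin_sq h).const_mul (4 * H2 q p)).const_add (1 / 2 * p 2 ^ 2)
  convert key.deriv using 1
  · unfold pdq
    congr 1
    funext t
    simp [H3, H2]
    ring
  · ring

theorem pdq_one_K3 (q p : Fin 3 → ℝ) (h : sin (q 1) ≠ 0) :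
    pdq 1 K3 q p = -sin (q 1) * p 2 ^ 2 - 4 * cos (q 1) * (cos (q 2) / sin (q 2)) * p 1 * p 2 +
      8 * (cos (q 2) / sin (q 2)) ^ 2 *
        (sin (q 1) * H2 q p + 4 * cos (q 1) ^ 2 / sin (q 1) ^ 3 * p 0 ^ 2) := by
  have key := (((hasDerivAt_cos (q 1)).mul_const
    (p 2 ^ 2 - 4 * (cos (q 2) / sin (q 2)) ^ 2 * p 1 ^ 2)).fun_sub
    ((hasDerivAt_sin (q 1)).mul_const (4 * (cos (q 2) / sin (q 2)) * p 1 * p 2))).fun_sub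
    (((hasDerivAt_cos (q 1)).fun_mul (hasDerivAt_inv_sin_sq h)).mul_const
      (16 * (cos (q 2) / sin (q 2)) ^ 2 * p 0 ^ 2))
  convert key.deriv using 1
  · unfold pdq
    congr 1
    funext t
    simp [K3, H2]
    ring
  · simp only [H2]
    ring

theorem pdq_two_K3 (q p : Fin 3 → ℝ) (h : sin (q 2) ≠ 0) :
    pdq 2 K3 q p = 4 * sin (q 1) / sin (q 2) ^ 2 * p 1 * p 2 +
      16 * cos (q 1) * cos (q 2) / sin (q 2) ^ 3 * H2 q p := by
  have key := (((hasDerivAt_cos_div_sin h).mul_const (4 * sin (q 1) * p 1 * p 2)).const_sub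
    (cos (q 1) * p 2 ^ 2)).fun_sub
    (((hasDerivAt_cos_div_sin h).fun_pow 2).mul_const (8 * cos (q 1) * H2 q p))
  convert key.deriv using 1
  · unfold pdq
    congr 1
    funext t
    simp [K3, H2]
    ring
  · simp only [Nat.cast_ofNat, Nat.add_one_sub_one, pow_one]
    field_simp
    ring

theorem pdp_one_H3 (q p : Fin 3 → ℝ) : pdp 1 H3 q p = 4 / sin (q 2) ^ 2 * p 1 := by
  convert deriv_quadratic (2 / sin (q 2) ^ 2) 0
    (1 / 2 * p 2 ^ 2 + 8 / (sin (q 2) ^ 2 * sin (q 1) ^ 2) * p 0 ^ 2) (p 1) using 1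
  · unfold pdp
    congr 1
    funext t
    simp [H3, H2]
    ring
  · ring

theorem pdp_two_H3 (q p : Fin 3 → ℝ) : pdp 2 H3 q p = p 2 := by
  convert deriv_quadratic (1 / 2) 0 (4 / sin (q 2) ^ 2 * H2 q p) (p 2) using 1
  · unfold pdp
    congr 1
    funext t
    simp [H3, H2]
  · ring

theorem pdp_one_K3 (q p : Fin 3 → ℝ) :
    pdp 1 K3 q p = -4 * sin (q 1) * (cos (q 2) / sin (q 2)) * p 2 -
      8 * cos (q 1) * (cos (q 2) / sin (q 2)) ^ 2 * p 1 := by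
  convert deriv_quadratic (-4 * cos (q 1) * (cos (q 2) / sin (q 2)) ^ 2)
    (-4 * sin (q 1) * (cos (q 2) / sin (q 2)) * p 2)
    (cos (q 1) * p 2 ^ 2 -
      16 * cos (q 1) * (cos (q 2) / sin (q 2)) ^ 2 / sin (q 1) ^ 2 * p 0 ^ 2) (p 1) using 1
  · unfold pdp
    congr 1
    funext t
    simp [K3, H2]
    ring
  · ring

theorem pdp_two_K3 (q p : Fin 3 → ℝ) :
    pdp 2 K3 q p = 2 * cos (q 1) * p 2 - 4 * sin (q 1) * (cos (q 2) / sin (q 2)) * p 1 := by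
  convert deriv_quadratic (cos (q 1)) (-4 * sin (q 1) * (cos (q 2) / sin (q 2)) * p 1)
    (-8 * cos (q 1) * (cos (q 2) / sin (q 2)) ^ 2 * H2 q p) (p 2) using 1
  · unfold pdp
    congr 1
    funext t
    simp [K3, H2]
    ring
  · ring

theorem stmt_6 (q p : Fin 3 → ℝ) (h2 : 0 < q 1) (h2' : q 1 < π)
    (h3 : 0 < q 2) (h3' : q 2 < π) :
    poissonBracket H3 K3 q p = 0 := by
  have hs := (sin_pos_of_pos_of_lt_pi h2 h2').ne'
  have hS := (sin_pos_of_pos_of_lt_pi h3 h3').ne'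
  rw [poissonBracket, Fin.sum_univ_three, pdq_zero_H3, pdq_zero_K3, pdq_one_H3 q p hs,
    pdq_one_K3 q p hs, pdq_two_H3 q p hS, pdq_two_K3 q p hS, pdp_one_H3, pdp_one_K3,
    pdp_two_H3, pdp_two_K3, H2]
  field_simp
  ring
end
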